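/- The map q ↦ (β_i), where (β_i) denotes the greedy expansion of 1 in base q with unbounded digits (with the convention (β_i) = 10^∞ for q = 1), is a strictly increasing one-to-one correspondence between the interval [1, ∞) and the set of all sequences (β_i) of nonnegative integers satisfying β_{n+1}β_{n+2}... < β_1β_2... (strict lexicographic inequality) for all n ≥ 1. -/

import Mathlib

/-- Strict lexicographic order on digit sequences (indexed from 0). -/
def LexLt (a b : ℕ → ℕ) : Prop :=
  ∃ n, (∀ k, k < n → a k = b k) ∧ a n < b n

/-- Non-strict lexicographic order on digit sequences. -/
def LexLe (a b : ℕ → ℕ) : Prop :=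
  LexLt a b ∨ a = b

/-- The next greedy digit with unbounded digits: the largest nonnegative integer `m`
with `s + m / q ^ (n+1) ≤ x`, where `s` is the value of the previously chosen digits. -/
noncomputable def gDigitU (q x s : ℝ) (n : ℕ) : ℕ :=
  sSup {m : ℕ | s + (m : ℝ) / q ^ (n + 1) ≤ x}

/-- Partial sums of the greedy expansion of `x` in base `q` with unbounded digits. -/
noncomputable def gSumU (q x : ℝ) : ℕ → ℝ
  | 0 => 0
  | n + 1 => gSumU q x n + (gDigitU q x (gSumU q x n) n : ℝ) / q ^ (n + 1)

/-- `greedyU q x n` is the `(n+1)`-st digit (indexing from 0) of the greedy expansion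
of `x` in base `q` with unbounded digits: recursively, it is the largest nonnegative
integer `b_n` with `b_1/q + ⋯ + b_n/q^n ≤ x`. -/
noncomputable def greedyU (q x : ℝ) (n : ℕ) : ℕ :=
  gDigitU q x (gSumU q x n) n

/-- The greedy expansion of `1` in base `q` with unbounded digits, with the convention
`(β_i) = 10^∞` for `q = 1`. -/
noncomputable def greedyOneU (q : ℝ) (n : ℕ) : ℕ :=
  if q = 1 then (if n = 0 then 1 else 0) else greedyU q 1 n

/-- `r` is the sequence of remainders witnessing that `b` is the digit sequence generated by the
greedy algorithm for `1` in base `q`. -/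
def IsGreedyOne (q : ℝ) (b : ℕ → ℕ) (r : ℕ → ℝ) : Prop :=
  r 0 = 1 ∧ ∀ n, q * r n = b n + r (n + 1) ∧ 0 ≤ r (n + 1) ∧ r (n + 1) < 1

theorem LexLt.irrefl (a : ℕ → ℕ) : ¬ LexLt a a := fun ⟨_, _, h⟩ => lt_irrefl _ h

theorem sum_digits_eq_sub {q : ℝ} (hq : 0 < q) {b : ℕ → ℕ} {r : ℕ → ℝ}
    (h : ∀ n, q * r n = b n + r (n + 1)) (n k : ℕ) :
    ∑ i ∈ Finset.range k, (b (n + i) : ℝ) / q ^ (i + 1) = r n - r (n + k) / q ^ k := by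
  induction k with
  | zero => simp
  | succ k ih =>
    have hb : (b (n + k) : ℝ) = q * r (n + k) - r (n + (k + 1)) := by
      rw [h (n + k)]; ring_nf
    rw [Finset.sum_range_succ, ih, hb]
    field_simp
    ring

theorem sSup_digit_eq_floor {y : ℝ} (hy : 0 ≤ y) : sSup {m : ℕ | (m : ℝ) ≤ y} = ⌊y⌋₊ := by
  have : {m : ℕ | (m : ℝ) ≤ y} = Set.Iic ⌊y⌋₊ := by
    ext m
    simp [Nat.le_floor_iff hy]
  rw [this, csSup_Iic]

theorem gDigitU_eq_floor {q x s : ℝ} (hq : 0 < q) (n : ℕ) (hs : s ≤ x) :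
    gDigitU q x s n = ⌊(x - s) * q ^ (n + 1)⌋₊ := by
  rw [← sSup_digit_eq_floor (mul_nonneg (sub_nonneg.2 hs) (by positivity)), gDigitU]
  congr 1
  ext m
  simp only [Set.mem_ofPred_eq]
  rw [← div_le_iff₀ (by positivity)]
  constructor <;> intro h <;> linarith

theorem gSumU_le {q x : ℝ} (hq : 0 < q) (hx : 0 ≤ x) (n : ℕ) : gSumU q x n ≤ x := by
  induction n with
  | zero => exact hx
  | succ n ih =>
    rw [gSumU, gDigitU_eq_floor hq n ih]
    have h := Nat.floor_le (mul_nonneg (sub_nonneg.2 ih) (by positivity : 0 ≤ q ^ (n + 1)))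
    rw [← div_le_iff₀ (by positivity)] at h
    linarith

theorem isGreedyOne_greedyU {q : ℝ} (hq : 0 < q) :
    IsGreedyOne q (greedyU q 1) fun n => (1 - gSumU q 1 n) * q ^ n := by
  refine ⟨by simp [gSumU], fun n => ?_⟩
  have hs := gSumU_le hq zero_le_one n
  have hnn : 0 ≤ (1 - gSumU q 1 n) * q ^ (n + 1) :=
    mul_nonneg (sub_nonneg.2 hs) (by positivity)
  have hd : greedyU q 1 n = ⌊(1 - gSumU q 1 n) * q ^ (n + 1)⌋₊ := gDigitU_eq_floor hq n hs
  have hr : (1 - gSumU q 1 (n + 1)) * q ^ (n + 1)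
      = (1 - gSumU q 1 n) * q ^ (n + 1) - greedyU q 1 n := by
    rw [gSumU, greedyU]
    field_simp
    ring
  have h1 := Nat.floor_le hnn
  have h2 := Nat.lt_floor_add_one ((1 - gSumU q 1 n) * q ^ (n + 1))
  simp only [hr]
  rw [← hd] at h1 h2
  refine ⟨by ring, by linarith, by linarith⟩

theorem IsGreedyOne.greedyU_eq {q : ℝ} (hq : 0 < q) {b : ℕ → ℕ} {r : ℕ → ℝ}
    (h : IsGreedyOne q b r) : greedyU q 1 = b := by
  have key : ∀ n, (1 - gSumU q 1 n) * q ^ n = r n → greedyU q 1 n = b n := by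
    intro n hn
    have hd : greedyU q 1 n = ⌊(1 - gSumU q 1 n) * q ^ (n + 1)⌋₊ :=
      gDigitU_eq_floor hq n (gSumU_le hq zero_le_one n)
    obtain ⟨h1, h2, h3⟩ := h.2 n
    have : (1 - gSumU q 1 n) * q ^ (n + 1) = b n + r (n + 1) := by
      rw [← h1, ← hn]; ring
    rw [hd, this, Nat.floor_eq_iff (by positivity)]
    constructor <;> linarith
  have hr : ∀ n, (1 - gSumU q 1 n) * q ^ n = r n := by
    intro n
    induction n with
    | zero => simp [gSumU, h.1]
    | succ n ih =>
      have h1 := ((isGreedyOne_greedyU hq).2 n).1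
      have h2 := (h.2 n).1
      rw [key n ih] at h1
      simp only [ih] at h1
      linarith
  exact funext fun n => key n (hr n)

theorem IsGreedyOne.remainder_le_one {q : ℝ} {b : ℕ → ℕ} {r : ℕ → ℝ} (h : IsGreedyOne q b r)
    (n : ℕ) : r n ≤ 1 := by
  cases n with
  | zero => exact h.1.le
  | succ n => exact (h.2 n).2.2.le

theorem IsGreedyOne.remainder_nonneg {q : ℝ} {b : ℕ → ℕ} {r : ℕ → ℝ} (h : IsGreedyOne q b r)
    (n : ℕ) : 0 ≤ r n := by
  cases n with
  | zero => exact h.1.symm ▸ zero_le_one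
  | succ n => exact (h.2 n).2.1

/-- Every digit sequence whose value in base `q` is less than `1` is lexicographically smaller than
the greedy expansion of `1`. -/
theorem IsGreedyOne.lexLt_of_sum_le {q : ℝ} (hq : 1 < q) {b c : ℕ → ℕ} {r : ℕ → ℝ}
    (h : IsGreedyOne q b r) {s : ℝ} (hs : s < 1)
    (hc : ∀ k, ∑ i ∈ Finset.range k, (c i : ℝ) / q ^ (i + 1) ≤ s) : LexLt c b := by
  have hq0 : 0 < q := by linarith
  have hsum := fun k => sum_digits_eq_sub hq0 (fun n => (h.2 n).1) 0 k
  simp only [zero_add, h.1] at hsum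
  by_cases hcb : c = b
  · subst hcb
    obtain ⟨k, hk⟩ := exists_pow_lt_of_lt_one (sub_pos.2 hs) (inv_lt_one_of_one_lt₀ hq)
    have h1 := hc k
    have h2 : r k / q ^ k ≤ q⁻¹ ^ k := by
      rw [div_eq_mul_inv, inv_pow]
      exact mul_le_of_le_one_left (by positivity) (h.remainder_le_one k)
    rw [hsum k] at h1
    linarith
  · have hex : ∃ m, c m ≠ b m := by
      by_contra! hall
      exact hcb (funext hall)
    classical
    have hlt : ∀ k, k < Nat.find hex → c k = b k := fun k hk => not_not.1 (Nat.find_min hex hk)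
    have hne := Nat.find_spec hex
    generalize Nat.find hex = m at hlt hne
    refine ⟨m, hlt, lt_of_le_of_ne (not_lt.1 fun hgt => ?_) hne⟩
    have h1 := hc (m + 1)
    have h2 : (b m : ℝ) + 1 ≤ c m := by exact_mod_cast hgt
    have h3 := hsum (m + 1)
    rw [Finset.sum_range_succ] at h1 h3
    rw [Finset.sum_congr rfl fun k hk => by rw [hlt k (Finset.mem_range.1 hk)]] at h1
    have h4 : ((b m : ℝ) + 1) / q ^ (m + 1) ≤ c m / q ^ (m + 1) := by gcongr
    have h5 : r (m + 1) / q ^ (m + 1) < 1 / q ^ (m + 1) := by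
      gcongr
      exact (h.2 m).2.2
    rw [add_div] at h4
    linarith

theorem greedyOneU_of_one_lt {q : ℝ} (hq : 1 < q) : greedyOneU q = greedyU q 1 := by
  funext n
  simp [greedyOneU, hq.ne']

theorem one_le_greedyOneU_zero {q : ℝ} (hq : 1 ≤ q) : 1 ≤ greedyOneU q 0 := by
  rcases hq.eq_or_lt with rfl | hq
  · simp [greedyOneU]
  · rw [greedyOneU_of_one_lt hq, greedyU, gDigitU_eq_floor (by linarith) 0 (by simp [gSumU])]
    simp [gSumU, Nat.one_le_floor_iff, hq.le]

theorem sum_greedyOneU_le_one {q : ℝ} (hq : 1 ≤ q) (k : ℕ) :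
    ∑ i ∈ Finset.range k, (greedyOneU q i : ℝ) / q ^ (i + 1) ≤ 1 := by
  rcases hq.eq_or_lt with rfl | hq
  · simp only [greedyOneU]
    cases k <;> simp
  · have hq0 : 0 < q := by linarith
    have h := isGreedyOne_greedyU hq0
    have hsum := sum_digits_eq_sub hq0 (fun n => (h.2 n).1) 0 k
    have hr := div_nonneg (h.remainder_nonneg k) (by positivity : 0 ≤ q ^ k)
    simp only [zero_add, h.1] at hsum
    rw [greedyOneU_of_one_lt hq, hsum]
    linarith

theorem greedyOneU_strictMono {q q' : ℝ} (hq : 1 ≤ q) (hqq : q < q') :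
    LexLt (greedyOneU q) (greedyOneU q') := by
  have hq0 : 0 < q := by linarith
  have hq'0 : 0 < q' := by linarith
  have hq' : 1 < q' := by linarith
  have hinv : 1 / q' < 1 / q := one_div_lt_one_div_of_lt hq0 hqq
  have hinv1 : 1 / q ≤ 1 := (div_le_one hq0).2 hq
  have hinv0 : 0 < 1 / q' := by positivity
  rw [greedyOneU_of_one_lt hq']
  refine (isGreedyOne_greedyU hq'0).lexLt_of_sum_le hq' (s := 1 - (1 / q - 1 / q'))
    (by linarith) fun k => ?_
  cases k with
  | zero => simp only [Finset.range_zero, Finset.sum_empty]; linarith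
  | succ k =>
    have h1 := sum_greedyOneU_le_one hq (k + 1)
    have h0 : (1 : ℝ) ≤ greedyOneU q 0 := by exact_mod_cast one_le_greedyOneU_zero hq
    rw [Finset.sum_range_succ'] at h1 ⊢
    have h2 : ∑ i ∈ Finset.range k, (greedyOneU q (i + 1) : ℝ) / q' ^ (i + 1 + 1)
        ≤ ∑ i ∈ Finset.range k, (greedyOneU q (i + 1) : ℝ) / q ^ (i + 1 + 1) := by
      gcongr
    simp only [zero_add, pow_one] at h1 ⊢
    have h3 : (1 / q - 1 / q') ≤ greedyOneU q 0 * (1 / q - 1 / q') :=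
      le_mul_of_one_le_left (by linarith) h0
    rw [mul_sub, mul_one_div, mul_one_div] at h3
    linarith

theorem greedyOneU_tail_lexLt {q : ℝ} (hq : 1 ≤ q) (n : ℕ) :
    LexLt (fun i => greedyOneU q (n + 1 + i)) (greedyOneU q) := by
  rcases hq.eq_or_lt with rfl | hq
  · exact ⟨0, by simp, by simp [greedyOneU]⟩
  · have hq0 : 0 < q := by linarith
    have h := isGreedyOne_greedyU hq0
    rw [greedyOneU_of_one_lt hq]
    refine h.lexLt_of_sum_le hq (h.2 n).2.2 fun k => ?_
    have hr := div_nonneg (h.remainder_nonneg (n + 1 + k)) (by positivity : 0 ≤ q ^ k)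
    rw [sum_digits_eq_sub hq0 (fun n => (h.2 n).1) (n + 1) k]
    linarith

theorem le_zero_of_tail_lexLt {β : ℕ → ℕ} (hβ : ∀ n, LexLt (fun i => β (n + 1 + i)) β) (n : ℕ) :
    β n ≤ β 0 := by
  cases n with
  | zero => rfl
  | succ n =>
    obtain ⟨m, hm, hlt⟩ := hβ n
    cases m with
    | zero => exact hlt.le
    | succ m => exact (hm 0 (Nat.succ_pos m)).le

theorem one_le_zero_of_tail_lexLt {β : ℕ → ℕ} (hβ : ∀ n, LexLt (fun i => β (n + 1 + i)) β) :
    1 ≤ β 0 := by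
  obtain ⟨m, -, hlt⟩ := hβ 0
  have := le_zero_of_tail_lexLt hβ m
  omega

theorem summable_digits {β : ℕ → ℕ} {B : ℕ} (hB : ∀ n, β n ≤ B) {x : ℝ} (hx0 : 0 ≤ x)
    (hx1 : x < 1) (n : ℕ) : Summable fun i => (β (n + i) : ℝ) * x ^ (i + 1) := by
  refine Summable.of_nonneg_of_le (fun i => by positivity) (fun i => ?_)
    (((summable_geometric_of_lt_one hx0 hx1).mul_left x).mul_left (B : ℝ))
  rw [pow_succ']
  gcongr
  exact_mod_cast hB _

theorem tsum_digits_le {β : ℕ → ℕ} {B : ℕ} (hB : ∀ n, β n ≤ B) {x : ℝ} (hx0 : 0 ≤ x)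
    (hx1 : x < 1) (n : ℕ) : ∑' i, (β (n + i) : ℝ) * x ^ (i + 1) ≤ B * (x * (1 - x)⁻¹) := by
  rw [← tsum_geometric_of_lt_one hx0 hx1, ← tsum_mul_left, ← tsum_mul_left]
  refine (summable_digits hB hx0 hx1 n).tsum_le_tsum (fun i => ?_)
    (((summable_geometric_of_lt_one hx0 hx1).mul_left x).mul_left (B : ℝ))
  rw [pow_succ']
  gcongr
  exact_mod_cast hB _

/-- A bounded digit sequence with digit sum at least `2` has value `1` in some base. -/
theorem exists_tsum_digits_eq_one {β : ℕ → ℕ} {B : ℕ} (hB : ∀ n, β n ≤ B) {N : ℕ}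
    (hN : 2 ≤ ∑ i ∈ Finset.range N, β i) :
    ∃ x : ℝ, 0 < x ∧ x < 1 ∧ ∑' i, (β i : ℝ) * x ^ (i + 1) = 1 := by
  have hsummable : ∀ x : ℝ, 0 ≤ x → x < 1 → Summable fun i => (β i : ℝ) * x ^ (i + 1) :=
    fun x h0 h1 => by simpa using summable_digits hB h0 h1 0
  have hcont : Continuous fun x : ℝ => ∑ i ∈ Finset.range N, (β i : ℝ) * x ^ (i + 1) := by
    fun_prop
  have hone : 1 < ∑ i ∈ Finset.range N, (β i : ℝ) * 1 ^ (i + 1) := by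
    simp only [one_pow, mul_one]
    exact_mod_cast hN
  obtain ⟨b, ⟨hb0, hb1⟩, hb⟩ : ∃ b : ℝ, b ∈ Set.Ioo 0 1 ∧
      1 < ∑ i ∈ Finset.range N, (β i : ℝ) * b ^ (i + 1) :=
    ((Filter.Eventually.and (Ioo_mem_nhdsLT zero_lt_one)
      (nhdsWithin_le_nhds (hcont.continuousAt.eventually_const_lt hone)))).exists
  have hfb : 1 < ∑' i, (β i : ℝ) * b ^ (i + 1) :=
    hb.trans_le ((hsummable b hb0.le hb1).sum_le_tsum _ fun i _ => by positivity)
  have hca : ContinuousOn (fun x : ℝ => ∑' i, (β i : ℝ) * x ^ (i + 1)) (Set.Icc 0 b) := by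
    refine continuousOn_tsum (fun i => by fun_prop) (hsummable b hb0.le hb1) fun i x hx => ?_
    rw [Real.norm_of_nonneg (mul_nonneg (Nat.cast_nonneg _) (pow_nonneg hx.1 _))]
    have := hx.1
    gcongr
    exact hx.2
  have hmem : (1 : ℝ) ∈ Set.Icc (∑' i, (β i : ℝ) * 0 ^ (i + 1)) (∑' i, (β i : ℝ) * b ^ (i + 1)) :=
    ⟨by simp, hfb.le⟩
  obtain ⟨x, hx, hfx⟩ := intermediate_value_Icc hb0.le hca hmem
  refine ⟨x, hx.1.lt_of_ne ?_, hx.2.trans_lt hb1, hfx⟩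
  rintro rfl
  simp at hfx

/-- If `β` dominates all of its tails and has value `1` in base `q`, then it is the greedy expansion
of `1`; here `r n` is the value of the `n`-th tail. -/
theorem isGreedyOne_of_tail_lexLt {q : ℝ} (hq : 1 < q) {β : ℕ → ℕ}
    (hβ : ∀ n, LexLt (fun i => β (n + 1 + i)) β) {r : ℕ → ℝ} (h0 : r 0 = 1)
    (hr : ∀ n, q * r n = β n + r (n + 1)) (hnn : ∀ n, 0 ≤ r n) {B : ℝ} (hB : ∀ n, r n ≤ B)
    (hzero : ∀ n, r n = 0 → ∀ k, r (n + k) = 0) : IsGreedyOne q β r := by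
  have hq0 : 0 < q := by linarith
  have hstep : ∀ n, ∃ m, (r (n + 1) - 1) * q ^ (m + 1) ≤ r (m + 1 + n + 1) - 1 - r (m + 1) := by
    intro n
    obtain ⟨m, hm, hlt⟩ := hβ n
    dsimp only at hm hlt
    refine ⟨m, ?_⟩
    have e1 := sum_digits_eq_sub hq0 hr (n + 1) (m + 1)
    have e2 := sum_digits_eq_sub hq0 hr 0 (m + 1)
    simp only [zero_add, h0] at e2
    rw [Finset.sum_range_succ] at e1 e2
    rw [Finset.sum_congr rfl fun k hk => by rw [hm k (Finset.mem_range.1 hk)]] at e1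
    have hlt' : (β (n + 1 + m) : ℝ) + 1 ≤ β m := by exact_mod_cast hlt
    have h4 : ((β (n + 1 + m) : ℝ) + 1) / q ^ (m + 1) ≤ β m / q ^ (m + 1) := by gcongr
    have h5 : r (n + 1) - 1 ≤ (r (m + 1 + n + 1) - 1 - r (m + 1)) / q ^ (m + 1) := by
      rw [show n + 1 + (m + 1) = m + 1 + n + 1 by ring] at e1
      rw [sub_div, sub_div]
      rw [add_div] at h4
      linarith
    rwa [le_div_iff₀ (by positivity)] at h5
  have hB0 : 0 ≤ B := (hnn 0).trans (hB 0)
  have hle : ∀ n, r (n + 1) ≤ 1 := by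
    have hbound : ∀ k n, r (n + 1) - 1 ≤ B * q⁻¹ ^ k := by
      intro k
      induction k with
      | zero => intro n; have := hB (n + 1); simp; linarith
      | succ k ih =>
        intro n
        obtain ⟨m, hm⟩ := hstep n
        by_cases hneg : r (n + 1) - 1 ≤ 0
        · exact hneg.trans (by positivity)
        · have h1 : q ≤ q ^ (m + 1) := le_self_pow₀ hq.le (Nat.succ_ne_zero m)
          have h2 : (r (n + 1) - 1) * q ≤ (r (n + 1) - 1) * q ^ (m + 1) :=
            mul_le_mul_of_nonneg_left h1 (by linarith)
          have h3 := ih (m + 1 + n)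
          have h4 := hnn (m + 1)
          have h5 : (r (n + 1) - 1) * q ≤ B * q⁻¹ ^ k := by linarith
          rwa [← le_div_iff₀ hq0, div_eq_mul_inv, mul_assoc, ← pow_succ] at h5
    intro n
    have hlim := (tendsto_pow_atTop_nhds_zero_of_lt_one (by positivity)
      (inv_lt_one_of_one_lt₀ hq)).const_mul B
    rw [mul_zero] at hlim
    linarith [ge_of_tendsto' hlim fun k => hbound k n]
  refine ⟨h0, fun n => ⟨hr n, hnn _, (hle n).lt_of_ne fun heq => ?_⟩⟩
  obtain ⟨m, hm⟩ := hstep n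
  rw [heq, sub_self, zero_mul] at hm
  have h1 := hle (m + 1 + n)
  have h2 := hnn (m + 1)
  have h3 := hzero (m + 1) (by linarith) (n + 1)
  rw [← add_assoc] at h3
  linarith

theorem exists_greedyOneU_eq {β : ℕ → ℕ} (hβ : ∀ n, LexLt (fun i => β (n + 1 + i)) β) :
    ∃ q : ℝ, 1 ≤ q ∧ greedyOneU q = β := by
  have hB := le_zero_of_tail_lexLt hβ
  have h1 := one_le_zero_of_tail_lexLt hβ
  by_cases hN : ∃ N, 2 ≤ ∑ i ∈ Finset.range N, β i
  · obtain ⟨N, hN⟩ := hN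
    obtain ⟨x, hx0, hx1, hx⟩ := exists_tsum_digits_eq_one hB hN
    have hq : 1 < x⁻¹ := (one_lt_inv₀ hx0).2 hx1
    refine ⟨x⁻¹, hq.le, ?_⟩
    rw [greedyOneU_of_one_lt hq]
    have hs := summable_digits hB hx0.le hx1
    refine (isGreedyOne_of_tail_lexLt hq hβ (r := fun n => ∑' i, (β (n + i) : ℝ) * x ^ (i + 1))
      (by simpa using hx) (fun n => ?_) (fun n => tsum_nonneg fun i => by positivity)
      (tsum_digits_le hB hx0.le hx1) fun n hn k => ?_).greedyU_eq (inv_pos.2 hx0)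
    · rw [(hs n).tsum_eq_zero_add, inv_mul_eq_iff_eq_mul₀ hx0.ne', mul_add, ← tsum_mul_left]
      congr 1
      · simp [mul_comm]
      · refine tsum_congr fun i => ?_
        rw [show n + (i + 1) = n + 1 + i by ring]
        ring
    · have hz := (hs n).hasSum
      rw [hn, hasSum_zero_iff_of_nonneg fun i => by positivity] at hz
      have hdigit : ∀ i, β (n + i) = 0 := fun i => by
        simpa [hx0.ne'] using congrFun hz i
      simp [add_assoc, hdigit]
  · push Not at hN
    refine ⟨1, le_rfl, funext fun n => ?_⟩
    have hn := hN (n + 1)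
    cases n with
    | zero => simp at hn; simp [greedyOneU]; omega
    | succ n =>
      rw [Finset.sum_range_succ, Finset.sum_range_succ'] at hn
      simp [greedyOneU]
      omega

/-- Theorem 3.6 (a): `q ↦ (β_i)`, the greedy expansion of `1` in base `q` with unbounded
digits (with the convention `(β_i) = 10^∞` for `q = 1`), is a strictly increasing
one-to-one correspondence between `[1, ∞)` and the set of all sequences of nonnegative
integers satisfying `β_{n+1}β_{n+2}… < β_1β_2…` for all `n ≥ 1`. -/
theorem greedyU_one_bijection :
    (∀ q q' : ℝ, 1 ≤ q → q < q' → LexLt (greedyOneU q) (greedyOneU q')) ∧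
    Set.BijOn (fun q : ℝ => greedyOneU q) (Set.Ici 1)
      {β : ℕ → ℕ | ∀ n, LexLt (fun i => β (n + 1 + i)) β} := by
  have hmono : ∀ q q' : ℝ, 1 ≤ q → q < q' → LexLt (greedyOneU q) (greedyOneU q') :=
    fun q q' hq hqq => greedyOneU_strictMono hq hqq
  refine ⟨hmono, fun q hq => greedyOneU_tail_lexLt hq, fun q hq q' hq' heq => ?_,
    fun β hβ => exists_greedyOneU_eq hβ⟩
  replace heq : greedyOneU q = greedyOneU q' := heq
  rcases lt_trichotomy q q' with hlt | rfl | hlt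
  · exact absurd (heq ▸ hmono q q' hq hlt) (LexLt.irrefl _)
  · rfl
  · exact absurd (heq ▸ hmono q' q hq' hlt) (LexLt.irrefl _)
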